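/- There exists a positive integer n0 such that for all n ≥ n0 the following holds. Let p satisfy ln(n)/n < p ≤ 2·ln(n)/n and let G ~ G(n,p). Then the probability that G contains a spanning subgraph Γ such that Γ is a non-Hamiltonian (⌊n/5⌋,2)-expander with at most n·(ln n)^{0.98} edges and |E(G) ∩ B_Γ| ≤ n·ln(n)/100, is at most exp(−n²p/401). -/

import Mathlib

open SimpleGraph Real

/-- External neighborhood of a vertex set `U`: all vertices outside `U`
with at least one neighbor in `U`. -/
def extNbhd {V : Type*} (G : SimpleGraph V) (U : Set V) : Set V :=
  {v | v ∉ U ∧ ∃ u ∈ U, G.Adj u v}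

/-- `G` is an `(R,c)`-expander: every vertex set of size at most `R`
has external neighborhood of size at least `c` times its own size. -/
def IsExpander {V : Type*} (G : SimpleGraph V) (R c : ℝ) : Prop :=
  ∀ U : Set V, (U.ncard : ℝ) ≤ R → c * (U.ncard : ℝ) ≤ ((extNbhd G U).ncard : ℝ)

/-- The length of a longest path in `G`. -/
noncomputable def maxPathLen {V : Type*} (G : SimpleGraph V) : ℕ :=
  sSup {n | ∃ (u w : V) (p : G.Walk u w), p.IsPath ∧ p.length = n}

/-- The set of boosters with respect to `G`: non-edges `{u,v}` whose addition either makes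
the graph Hamiltonian or strictly increases the length of a longest path. -/
def boosters {V : Type*} [Fintype V] [DecidableEq V] (G : SimpleGraph V) : Set (Sym2 V) :=
  {e | ¬e.IsDiag ∧ e ∉ G.edgeSet ∧
    ((G ⊔ SimpleGraph.fromEdgeSet {e}).IsHamiltonian ∨
      maxPathLen G < maxPathLen (G ⊔ SimpleGraph.fromEdgeSet {e}))}

/-- The probability that the binomial random graph `G(n,p)` (on vertex set `Fin n`,
each of the `n.choose 2` possible edges present independently with probability `p`)
satisfies the property `P`. -/
noncomputable def probGnp (n : ℕ) (p : ℝ) (P : Set (SimpleGraph (Fin n))) : ℝ :=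
  ∑ G : SimpleGraph (Fin n),
    P.indicator (fun G => p ^ G.edgeSet.ncard * (1 - p) ^ (n.choose 2 - G.edgeSet.ncard)) G

section PosaRotation

variable {V : Type*}

/-- A nonempty duplicate-free list of vertices whose consecutive entries are adjacent. -/
structure IsPathList (G : SimpleGraph V) (l : List V) : Prop where
  ne_nil : l ≠ []
  chain : l.IsChain G.Adj
  nodup : l.Nodup

/-- A path list of maximum length. -/
def IsLongestPathList (G : SimpleGraph V) (l : List V) : Prop :=
  IsPathList G l ∧ ∀ l', IsPathList G l' → l'.length ≤ l.length

/-- A single Pósa rotation of a path list, keeping its first vertex. -/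
def PosaRot (G : SimpleGraph V) (l l' : List V) : Prop :=
  ∃ a v b t, l = a ++ v :: b ∧ t ∈ b.getLast? ∧ G.Adj v t ∧ l' = a ++ v :: b.reverse

/-- The last vertices of the path lists reachable from `l` by Pósa rotations. -/
def posaEnds (G : SimpleGraph V) (l : List V) : Set V :=
  {t | ∃ l', Relation.ReflTransGen (PosaRot G) l l' ∧ t ∈ l'.getLast?}

variable {G : SimpleGraph V} {l l' : List V}

lemma PosaRot.perm (h : PosaRot G l l') : l'.Perm l := by
  obtain ⟨a, v, b, t, rfl, -, -, rfl⟩ := h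
  exact ((List.reverse_perm b).cons v).append_left a

lemma PosaRot.head?_eq (h : PosaRot G l l') : l'.head? = l.head? := by
  obtain ⟨a, v, b, t, rfl, -, -, rfl⟩ := h
  cases a <;> simp

lemma PosaRot.isPathList (h : PosaRot G l l') (hl : IsPathList G l) : IsPathList G l' := by
  refine ⟨?_, ?_, h.perm.nodup_iff.2 hl.nodup⟩
  · obtain ⟨a, v, b, t, rfl, -, -, rfl⟩ := h
    simp
  · have hc := hl.chain
    obtain ⟨a, v, b, t, rfl, ht, hvt, rfl⟩ := h
    rw [List.isChain_append, List.isChain_cons] at hc ⊢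
    refine ⟨hc.1, ⟨?_, ?_⟩, ?_⟩
    · intro y hy
      rw [List.head?_reverse] at hy
      rw [Option.mem_unique hy ht]
      exact hvt
    · rw [List.isChain_reverse]
      exact hc.2.1.2.imp fun _ _ h => h.symm
    · simpa using hc.2.2

lemma PosaRot.isLongestPathList (h : PosaRot G l l') (hl : IsLongestPathList G l) :
    IsLongestPathList G l' :=
  ⟨h.isPathList hl.1, fun m hm => h.perm.length_eq ▸ hl.2 m hm⟩

lemma IsLongestPathList.of_reflTransGen (hl : IsLongestPathList G l)
    (h : Relation.ReflTransGen (PosaRot G) l l') :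
    IsLongestPathList G l' ∧ l'.head? = l.head? ∧ l'.Perm l := by
  induction h with
  | refl => exact ⟨hl, rfl, .refl _⟩
  | tail _ hr ih =>
    exact ⟨hr.isLongestPathList ih.1, hr.head?_eq.trans ih.2.1, hr.perm.trans ih.2.2⟩

/-- Rotations preserve the fact that no path neighbor of `v` is a rotation endpoint. -/
lemma PosaRot.isChain_of_notMem {T : Set V} {v : V} (h : PosaRot G l l') (hv : v ∉ T)
    (hlast : ∀ t ∈ l.getLast?, t ∈ T) (hlast' : ∀ t ∈ l'.getLast?, t ∈ T)
    (hc : l.IsChain fun x y => (x = v → y ∉ T) ∧ (y = v → x ∉ T)) :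
    l'.IsChain fun x y => (x = v → y ∉ T) ∧ (y = v → x ∉ T) := by
  obtain ⟨a, w, b, t, rfl, ht, hvt, rfl⟩ := h
  rw [List.isChain_append, List.isChain_cons] at hc ⊢
  refine ⟨hc.1, ⟨?_, ?_⟩, ?_⟩
  · intro y hy
    have htT : y ∈ T := by
      apply hlast
      rw [List.head?_reverse] at hy
      simp only [Option.mem_def] at hy ⊢
      rw [List.getLast?_append, List.getLast?_cons, hy]
      simp
    refine ⟨?_, fun h => absurd htT (h ▸ hv)⟩
    rintro rfl
    obtain ⟨z, hz⟩ : ∃ z, b.head? = some z := by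
      cases b
      · simp at ht
      · simp
    have hzT : z ∈ T := by
      apply hlast'
      simp only [Option.mem_def]
      rw [List.getLast?_append, List.getLast?_cons, List.getLast?_reverse, hz]
      simp
    exact absurd hzT ((hc.2.1.1 z hz).1 rfl)
  · rw [List.isChain_reverse]
    exact hc.2.1.2.imp fun _ _ h => h.symm
  · simpa using hc.2.2

lemma mem_of_adj_last (hl : IsLongestPathList G l) {t v : V} (ht : t ∈ l.getLast?)
    (h : G.Adj t v) : v ∈ l := by
  by_contra hv
  have := hl.2 (l ++ [v]) ⟨by simp, ?_, ?_⟩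
  · simp at this
  · rw [List.isChain_append]
    refine ⟨hl.1.chain, by simp, ?_⟩
    intro x hx y hy
    simp only [List.head?_cons, Option.mem_def, Option.some.injEq] at hy
    rw [Option.mem_unique hx ht, ← hy]
    exact h
  · rw [List.nodup_append]
    refine ⟨hl.1.nodup, by simp, ?_⟩
    rintro a ha b hb rfl
    simp at hb
    exact hv (hb ▸ ha)

/-- A neighbor of a rotation endpoint is next to a rotation endpoint on the original path. -/
lemma exists_getElem_of_mem_extNbhd (hl : IsLongestPathList G l) {v : V}
    (hv : v ∈ extNbhd G (posaEnds G l)) :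
    ∃ (i : ℕ) (h : i + 1 < l.length), (l[i] = v ∧ l[i + 1] ∈ posaEnds G l) ∨
      (l[i + 1] = v ∧ l[i] ∈ posaEnds G l) := by
  obtain ⟨hvT, t, ⟨l', hl', ht⟩, hadj⟩ := hv
  by_contra hcon
  have hc : l.IsChain fun x y =>
      (x = v → y ∉ posaEnds G l) ∧ (y = v → x ∉ posaEnds G l) := by
    rw [List.isChain_iff_getElem]
    intro i hi
    push Not at hcon
    exact hcon i hi
  have hc' : l'.IsChain fun x y =>
      (x = v → y ∉ posaEnds G l) ∧ (y = v → x ∉ posaEnds G l) := by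
    clear ht
    induction hl' with
    | refl => exact hc
    | tail h1 h2 ih =>
      exact h2.isChain_of_notMem hvT (fun s hs => ⟨_, h1, hs⟩)
        (fun s hs => ⟨_, h1.tail h2, hs⟩) ih
  have hlong := (hl.of_reflTransGen hl').1
  have hvl := mem_of_adj_last hlong ht hadj
  obtain ⟨a, b, rfl⟩ := List.append_of_mem hvl
  cases b with
  | nil =>
    simp at ht
    subst ht
    exact G.irrefl hadj
  | cons w c =>
    rw [List.isChain_append_cons_cons] at hc'
    refine hc'.2.1.1 rfl ?_
    have ht' : t ∈ (w :: c).getLast? := by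
      simpa [List.getLast?_append, List.getLast?_cons] using ht
    refine ⟨a ++ v :: (w :: c).reverse, hl'.tail ⟨a, v, w :: c, t, rfl, ht', hadj.symm, rfl⟩, ?_⟩
    simp [List.getLast?_append, List.getLast?_cons]

lemma posaEnds_subset (hl : IsLongestPathList G l) : posaEnds G l ⊆ {v | v ∈ l} := by
  rintro t ⟨l', h, ht⟩
  exact (hl.of_reflTransGen h).2.2.subset (List.mem_of_getLast? ht)

/-- **Pósa's lemma**: the rotation endpoints have fewer than twice as many neighbors. -/
lemma ncard_extNbhd_posaEnds_lt [Finite V] (hl : IsLongestPathList G l) :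
    (extNbhd G (posaEnds G l)).ncard < 2 * (posaEnds G l).ncard := by
  classical
  set T := posaEnds G l with hT
  have hlast : l.getLast hl.1.ne_nil ∈ T :=
    ⟨l, .refl, by simp [List.getLast?_eq_getLast_of_ne_nil hl.1.ne_nil]⟩
  set z := l.getLast hl.1.ne_nil with hz
  let f : V → V := fun t => l.getD (l.idxOf t - 1) z
  let g : V → V := fun t => l.getD (l.idxOf t + 1) z
  have hsub : extNbhd G T ⊆ Set.image f T ∪ Set.image g (T \ {z}) := by
    intro v hv
    obtain ⟨i, hi, ⟨rfl, h⟩ | ⟨rfl, h⟩⟩ := exists_getElem_of_mem_extNbhd hl hv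
    · left
      refine ⟨_, h, ?_⟩
      simp only [f, hl.1.nodup.idxOf_getElem]
      grind
    · right
      refine ⟨_, ⟨h, ?_⟩, ?_⟩
      · rw [Set.mem_singleton_iff, hz, List.getLast_eq_getElem, hl.1.nodup.getElem_inj_iff]
        lia
      · simp only [g, hl.1.nodup.idxOf_getElem]
        grind
  have h1 := Set.ncard_le_ncard hsub (Set.toFinite _)
  have h2 := Set.ncard_union_le (Set.image f T) (Set.image g (T \ {z}))
  have h3 := Set.ncard_image_le (f := f) (Set.toFinite T)
  have h4 := Set.ncard_image_le (f := g) (Set.toFinite (T \ {z}))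
  have h5 := Set.ncard_sdiff_singleton_add_one hlast (Set.toFinite T)
  lia

lemma IsExpander.lt_ncard_posaEnds [Finite V] {R : ℕ} (hG : IsExpander G R 2)
    (hl : IsLongestPathList G l) : R < (posaEnds G l).ncard := by
  by_contra! h
  have h1 := hG (posaEnds G l) (by exact_mod_cast h)
  have h2 := ncard_extNbhd_posaEnds_lt hl
  have : 2 * (posaEnds G l).ncard ≤ (extNbhd G (posaEnds G l)).ncard := by exact_mod_cast h1
  lia

lemma IsPathList.reverse (hl : IsPathList G l) : IsPathList G l.reverse :=
  ⟨by simpa using hl.ne_nil, List.isChain_reverse.2 (hl.chain.imp fun _ _ h => h.symm),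
    List.nodup_reverse.2 hl.nodup⟩

lemma IsLongestPathList.reverse (hl : IsLongestPathList G l) : IsLongestPathList G l.reverse :=
  ⟨hl.1.reverse, by simpa using hl.2⟩

lemma exists_isLongestPathList [Fintype V] [Nonempty V] (G : SimpleGraph V) :
    ∃ l, IsLongestPathList G l := by
  classical
  let v : V := Classical.arbitrary V
  obtain ⟨n, ⟨⟨l, hl, rfl⟩, hmax⟩⟩ : ∃ n, IsGreatest {n | ∃ l, IsPathList G l ∧ l.length = n} n := by
    apply BddAbove.exists_isGreatest_of_nonempty
    · refine ⟨Fintype.card V, ?_⟩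
      rintro _ ⟨l, hl, rfl⟩
      exact hl.nodup.length_le_card
    · exact ⟨1, [v], ⟨by simp, by simp, by simp⟩, rfl⟩
  exact ⟨l, hl, fun l' hl' => hmax ⟨l', hl', rfl⟩⟩

lemma IsPathList.length_le_maxPathLen [Fintype V] (hl : IsPathList G l) :
    l.length ≤ maxPathLen G + 1 := by
  have : l.length - 1 ≤ maxPathLen G := by
    refine le_csSup ⟨Fintype.card V, ?_⟩ ⟨_, _, Walk.ofSupport l hl.ne_nil hl.chain, ?_, ?_⟩
    · rintro _ ⟨u, w, p, hp, rfl⟩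
      exact hp.length_lt.le
    · rw [Walk.isPath_def, Walk.support_ofSupport]
      exact hl.nodup
    · simp
  lia

lemma IsLongestPathList.maxPathLen_lt [Fintype V] (hl : IsLongestPathList G l) :
    maxPathLen G < l.length := by
  have : maxPathLen G ≤ l.length - 1 := by
    apply csSup_le'
    rintro _ ⟨u, w, p, hp, rfl⟩
    have := hl.2 p.support ⟨by simp, p.isChain_adj_support, hp.support_nodup⟩
    simp at this
    lia
  have := List.length_pos_iff.2 hl.1.ne_nil
  lia

lemma IsPathList.isHamiltonian [Fintype V] [DecidableEq V] (hl : IsPathList G l)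
    {u t : V} (hu : u ∈ l.head?) (ht : t ∈ l.getLast?) (hadj : G.Adj t u) (h3 : 3 ≤ l.length)
    (hall : ∀ v, v ∈ l) : G.IsHamiltonian := by
  intro _
  have hu' : l.head hl.ne_nil = u := by
    rw [List.head?_eq_some_head hl.ne_nil] at hu; simpa using hu
  have ht' : l.getLast hl.ne_nil = t := by
    rw [List.getLast?_eq_some_getLast hl.ne_nil] at ht; simpa using ht
  subst hu' ht'
  refine ⟨_, Walk.cons hadj (Walk.ofSupport l hl.ne_nil hl.chain), ?_⟩
  have hp : (Walk.ofSupport l hl.ne_nil hl.chain).IsPath := by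
    rw [Walk.isPath_def, Walk.support_ofSupport]
    exact hl.nodup
  rw [Walk.isHamiltonianCycle_iff_isCycle_and_support_count_tail_eq_one,
    Walk.isCycle_iff_isPath_tail_and_le_length]
  refine ⟨⟨by simpa using hp, by simp; lia⟩, fun a => ?_⟩
  simp only [Walk.support_cons, List.tail_cons, Walk.support_ofSupport]
  exact List.count_eq_one_of_mem hl.nodup (hall a)

/-- A path whose ends are adjacent is Hamiltonian or can be extended, in a graph without
nontrivial vertex sets closed under adjacency. -/
lemma IsPathList.isHamiltonian_or_exists_longer [Fintype V] [DecidableEq V]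
    (hG : ∀ A : Set V, A.Nonempty → Aᶜ.Nonempty → ∃ x ∈ A, ∃ y ∉ A, G.Adj x y)
    (hl : IsPathList G l) {u t : V} (hu : u ∈ l.head?) (ht : t ∈ l.getLast?)
    (hadj : G.Adj t u) (h3 : 3 ≤ l.length) :
    G.IsHamiltonian ∨ ∃ l', IsPathList G l' ∧ l.length < l'.length := by
  by_cases hall : ∀ v, v ∈ l
  · exact .inl (hl.isHamiltonian hu ht hadj h3 hall)
  push Not at hall
  right
  obtain ⟨x, hx, y, hy, hxy⟩ := hG {v | v ∈ l} ⟨u, List.mem_of_head? hu⟩ hall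
  obtain ⟨a, b, rfl⟩ := List.append_of_mem (show x ∈ l from hx)
  refine ⟨y :: ((x :: b) ++ a), ⟨by simp, ?_, ?_⟩, by simp; lia⟩
  · have hc := hl.chain
    rw [List.isChain_append] at hc
    rw [List.isChain_cons, List.isChain_append]
    refine ⟨by simpa using hxy.symm, hc.2.1, hc.1, ?_⟩
    intro s hs w hw
    have e1 : s = t := by
      apply Option.mem_unique _ ht
      simpa [List.getLast?_append, List.getLast?_cons] using hs
    have e2 : w = u := by
      apply Option.mem_unique _ hu
      cases a
      · simp at hw
      · simpa using hw
    rw [e1, e2]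
    exact hadj
  · rw [List.nodup_cons]
    refine ⟨?_, (List.perm_append_comm.nodup_iff).1 hl.nodup⟩
    rw [List.perm_append_comm.mem_iff]
    exact hy

end PosaRotation

section Boosters

lemma IsExpander.exists_adj_of_nonempty {n : ℕ} (hn : 25 ≤ n) {G : SimpleGraph (Fin n)}
    (hG : IsExpander G ((n / 5 : ℕ) : ℝ) 2) (A : Set (Fin n)) (hA : A.Nonempty)
    (hA' : Aᶜ.Nonempty) : ∃ x ∈ A, ∃ y ∉ A, G.Adj x y := by
  have key : ∀ A : Set (Fin n), A.Nonempty → 2 * A.ncard ≤ n → ∃ x ∈ A, ∃ y ∉ A, G.Adj x y := by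
    intro A hA hcard
    by_contra! hcon
    obtain ⟨B, hBA, hB⟩ : ∃ B ⊆ A, B.ncard = min A.ncard (n / 5) :=
      Set.exists_subset_card_eq (min_le_left _ _)
    have h1 := hG B (by rw [hB]; exact_mod_cast min_le_right _ _)
    have h1' : 2 * B.ncard ≤ (extNbhd G B).ncard := by exact_mod_cast h1
    have h2 : extNbhd G B ⊆ A \ B := by
      rintro v ⟨hv, u, hu, huv⟩
      refine ⟨?_, hv⟩
      by_contra hvA
      exact hcon u (hBA hu) v hvA huv
    have h3 := Set.ncard_le_ncard h2 (Set.toFinite _)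
    have h4 := Set.ncard_sdiff_add_ncard_of_subset hBA (Set.toFinite _)
    have h5 := (Set.ncard_pos (Set.toFinite A)).2 hA
    lia
  have hsum := Set.ncard_add_ncard_compl A
  rw [Nat.card_eq_fintype_card, Fintype.card_fin] at hsum
  rcases le_total (2 * A.ncard) n with h | h
  · exact key A hA h
  · obtain ⟨x, hx, y, hy, hxy⟩ := key Aᶜ hA' (by lia)
    exact ⟨y, by simpa using hy, x, hx, hxy.symm⟩

lemma mk_mem_boosters {n : ℕ} (hn : 25 ≤ n) {G : SimpleGraph (Fin n)}
    (hG : IsExpander G ((n / 5 : ℕ) : ℝ) 2) (hham : ¬G.IsHamiltonian) {l : List (Fin n)}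
    (hl : IsLongestPathList G l) {u t : Fin n} (hu : u ∈ l.head?) (ht : t ∈ l.getLast?) :
    s(u, t) ∈ boosters G := by
  have hlen : 3 ≤ l.length := by
    have h1 := hG.lt_ncard_posaEnds hl
    have h2 := Set.ncard_le_ncard (posaEnds_subset hl) (Set.toFinite _)
    have h3 : {v | v ∈ l}.ncard ≤ l.length := by
      rw [← List.coe_toFinset, Set.ncard_coe_finset]
      exact List.toFinset_card_le l
    lia
  have hne : u ≠ t := by
    rintro rfl
    have hnd := hl.1.nodup
    cases l with
    | nil => simp at hu
    | cons a b =>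
      simp only [List.head?_cons, Option.mem_def, Option.some.injEq] at hu
      cases b with
      | nil => simp at hlen
      | cons c d =>
        rw [List.getLast?_cons_cons] at ht
        exact (List.nodup_cons.1 hnd).1 (hu ▸ List.mem_of_getLast? ht)
  have hconn := hG.exists_adj_of_nonempty hn
  refine ⟨by simpa using hne, ?_, ?_⟩
  · intro hadj
    rw [SimpleGraph.mem_edgeSet] at hadj
    rcases hl.1.isHamiltonian_or_exists_longer hconn hu ht hadj.symm hlen with h | ⟨l', h, h'⟩
    · exact hham h
    · exact absurd (hl.2 l' h) (by lia)
  · set H := G ⊔ SimpleGraph.fromEdgeSet {s(u, t)} with hH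
    have hGH : G ≤ H := le_sup_left
    have hlH : IsPathList H l := ⟨hl.1.ne_nil, hl.1.chain.imp fun _ _ h => hGH h, hl.1.nodup⟩
    have hconnH : ∀ A : Set (Fin n), A.Nonempty → Aᶜ.Nonempty → ∃ x ∈ A, ∃ y ∉ A, H.Adj x y := by
      intro A h1 h2
      obtain ⟨x, hx, y, hy, hxy⟩ := hconn A h1 h2
      exact ⟨x, hx, y, hy, hGH hxy⟩
    have hadj : H.Adj t u := by simp [hH, hne.symm, Sym2.eq_swap]
    rcases hlH.isHamiltonian_or_exists_longer hconnH hu ht hadj hlen with h | ⟨l', h, h'⟩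
    · exact .inl h
    · right
      have h1 := hl.maxPathLen_lt
      have h2 := h.length_le_maxPathLen
      lia

lemma card_le_two_mul_ncard_of_mk_mem {V : Type*} [Finite V] {S : Finset (V × V)}
    {B : Set (Sym2 V)} (h : ∀ x ∈ S, s(x.1, x.2) ∈ B) : S.card ≤ 2 * B.ncard := by
  classical
  refine (Finset.card_le_mul_card_image (f := fun x : V × V => s(x.1, x.2)) S 2 ?_).trans ?_
  · intro b _
    induction b with | _ x y =>
    refine (Finset.card_le_card (t := {(x, y), (y, x)}) ?_).trans Finset.card_le_two
    rintro ⟨p, q⟩ hpq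
    simpa using (Finset.mem_filter.1 hpq).2
  · rw [← Set.ncard_coe_finset]
    gcongr
    · exact Set.toFinite B
    · intro b hb
      simp only [Finset.coe_image, Set.mem_image] at hb
      obtain ⟨x, hx, rfl⟩ := hb
      exact h x hx

/-- A non-Hamiltonian `(⌊n/5⌋, 2)`-expander has at least `n² / 50` boosters. -/
lemma IsExpander.sq_le_ncard_boosters {n : ℕ} (hn : 25 ≤ n) {G : SimpleGraph (Fin n)}
    (hG : IsExpander G ((n / 5 : ℕ) : ℝ) 2) (hham : ¬G.IsHamiltonian) :
    n ^ 2 ≤ 50 * (boosters G).ncard := by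
  classical
  have : Nonempty (Fin n) := ⟨⟨0, by lia⟩⟩
  obtain ⟨l, hl⟩ := exists_isLongestPathList G
  have h1 := hG.lt_ncard_posaEnds hl
  have hT : ∀ s ∈ posaEnds G l, ∃ l', IsLongestPathList G l' ∧ s ∈ l'.head? := by
    rintro s ⟨l', h, hs⟩
    exact ⟨l'.reverse, (hl.of_reflTransGen h).1.reverse, by simpa using hs⟩
  choose! f hf hfs using hT
  let S : Finset (Fin n × Fin n) :=
    (posaEnds G l).toFinite.toFinset.biUnion fun s =>
      ((posaEnds G (f s)).toFinite.toFinset).map ⟨Prod.mk s, Prod.mk_right_injective s⟩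
  have hS : ∀ x ∈ S, s(x.1, x.2) ∈ boosters G := by
    intro x hx
    simp only [S, Finset.mem_biUnion, Finset.mem_map, Set.Finite.mem_toFinset,
      Function.Embedding.coeFn_mk] at hx
    obtain ⟨s, hs, t, ⟨l', h, ht⟩, rfl⟩ := hx
    obtain ⟨h1, h2, -⟩ := (hf s hs).of_reflTransGen h
    exact mk_mem_boosters hn hG hham h1 (h2 ▸ hfs s hs) ht
  have h2 := card_le_two_mul_ncard_of_mk_mem hS
  have h3 : (n / 5 + 1) * (n / 5 + 1) ≤ S.card := by
    rw [Finset.card_biUnion]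
    · calc (n / 5 + 1) * (n / 5 + 1) ≤ (posaEnds G l).toFinite.toFinset.card * (n / 5 + 1) := by
            rw [← Set.ncard_eq_toFinset_card]
            gcongr
            exact h1
        _ ≤ _ := by
            rw [← smul_eq_mul]
            apply Finset.card_nsmul_le_sum
            intro s hs
            rw [Finset.card_map, ← Set.ncard_eq_toFinset_card]
            exact hG.lt_ncard_posaEnds (hf s (by simpa using hs))
    · intro a _ b _ hab
      rw [Function.onFun, Finset.disjoint_left]
      rintro x hx hx'
      simp only [Finset.mem_map, Function.Embedding.coeFn_mk] at hx hx'
      obtain ⟨_, _, rfl⟩ := hx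
      obtain ⟨_, _, h⟩ := hx'
      exact hab (congrArg Prod.fst h).symm
  have h4 : n ≤ 5 * (n / 5 + 1) := by lia
  calc n ^ 2 ≤ (5 * (n / 5 + 1)) ^ 2 := by gcongr
    _ = 25 * ((n / 5 + 1) * (n / 5 + 1)) := by ring
    _ ≤ 50 * (boosters G).ncard := by lia

end Boosters

section RandomGraph

open scoped Classical in
/-- The edge set of a finite graph, as a finset. -/
noncomputable def edges {n : ℕ} (G : SimpleGraph (Fin n)) : Finset (Sym2 (Fin n)) :=
  G.edgeSet.toFinset

lemma mem_edges {n : ℕ} {G : SimpleGraph (Fin n)} {e : Sym2 (Fin n)} :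
    e ∈ edges G ↔ e ∈ G.edgeSet := by
  simp [edges]

lemma ncard_edgeSet_eq_card_edges {n : ℕ} (G : SimpleGraph (Fin n)) :
    G.edgeSet.ncard = (edges G).card := by
  rw [← Set.ncard_coe_finset, edges, Set.coe_toFinset]

lemma edges_subset_top {n : ℕ} (G : SimpleGraph (Fin n)) : edges G ⊆ edges ⊤ := by
  intro e he
  rw [mem_edges] at *
  exact edgeSet_mono le_top he

lemma card_edges_top (n : ℕ) : (edges (⊤ : SimpleGraph (Fin n))).card = n.choose 2 := by
  have h := card_edgeFinset_top_eq_card_choose_two (V := Fin n)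
  rw [Fintype.card_fin] at h
  rw [← h]
  congr 1
  ext e
  simp [mem_edges]

lemma sum_prod_edges_le {n : ℕ} (f g : Sym2 (Fin n) → ℝ) (hf : ∀ e, 0 ≤ f e)
    (hg : ∀ e, 0 ≤ g e) :
    ∑ G : SimpleGraph (Fin n), (∏ e ∈ edges G, f e) * ∏ e ∈ edges ⊤ \ edges G, g e ≤
      ∏ e ∈ edges (⊤ : SimpleGraph (Fin n)), (f e + g e) := by
  rw [Finset.prod_add]
  have hinj : Function.Injective (edges : SimpleGraph (Fin n) → _) := by
    intro G H h
    apply edgeSet_injective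
    ext e
    rw [← mem_edges, h, mem_edges]
  rw [← Finset.sum_image (s := Finset.univ) (g := edges)
    (f := fun t => (∏ e ∈ t, f e) * ∏ e ∈ edges ⊤ \ t, g e) hinj.injOn]
  apply Finset.sum_le_sum_of_subset_of_nonneg
  · intro t ht
    obtain ⟨G, -, rfl⟩ := Finset.mem_image.1 ht
    exact Finset.mem_powerset.2 (edges_subset_top G)
  · intro t _ _
    exact mul_nonneg (Finset.prod_nonneg fun e _ => hf e) (Finset.prod_nonneg fun e _ => hg e)

/-- The probability that `G(n,p)` contains `Γ` and few edges of a set `B` of non-edges of `Γ`. -/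
lemma probGnp_le_of_disjoint {n : ℕ} {p K : ℝ} (hp0 : 0 ≤ p) (hp1 : p ≤ 1)
    (Γ : SimpleGraph (Fin n)) {B : Set (Sym2 (Fin n))} (hB : ∀ e ∈ B, ¬e.IsDiag ∧ e ∉ Γ.edgeSet) :
    probGnp n p {G | Γ ≤ G ∧ ((G.edgeSet ∩ B).ncard : ℝ) ≤ K} ≤
      2 ^ K * (p ^ Γ.edgeSet.ncard * (1 - p / 2) ^ B.ncard) := by
  classical
  set f : Sym2 (Fin n) → ℝ := fun e => p * if e ∈ B then 2⁻¹ else 1 with hf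
  set g : Sym2 (Fin n) → ℝ := fun e => if e ∈ Γ.edgeSet then 0 else 1 - p with hg
  have hf0 : ∀ e, 0 ≤ f e := fun e => by simp only [hf]; positivity
  have hg0 : ∀ e, 0 ≤ g e := fun e => by simp only [hg]; split_ifs <;> linarith
  have hprod : ∏ e ∈ edges (⊤ : SimpleGraph (Fin n)), (f e + g e) =
      p ^ Γ.edgeSet.ncard * (1 - p / 2) ^ B.ncard := by
    have h1 : ∀ e, f e + g e =
        (if e ∈ Γ.edgeSet then p else 1) * if e ∈ B then 1 - p / 2 else 1 := by
      intro e
      by_cases h1 : e ∈ Γ.edgeSet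
      · have h2 : e ∉ B := fun h => (hB e h).2 h1
        simp [hf, hg, h1, h2]
      · by_cases h2 : e ∈ B
        · simp only [hf, hg, h1, h2, if_true, if_false]; ring
        · simp [hf, hg, h1, h2]
    rw [Finset.prod_congr rfl fun e _ => h1 e, Finset.prod_mul_distrib, ← Finset.prod_filter,
      ← Finset.prod_filter, Finset.prod_const, Finset.prod_const]
    congr 2
    · rw [ncard_edgeSet_eq_card_edges]
      congr 1
      ext e
      rw [Finset.mem_filter, ← mem_edges]
      exact ⟨fun h => h.2, fun h => ⟨edges_subset_top Γ h, h⟩⟩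
    · rw [← Set.ncard_coe_finset]
      congr 1
      ext e
      simp only [Finset.coe_filter, mem_edges, Set.mem_ofPred_eq, edgeSet_top]
      exact ⟨fun h => h.2, fun h => ⟨(hB e h).1, h⟩⟩
  rw [← hprod]
  refine le_trans ?_ (mul_le_mul_of_nonneg_left (sum_prod_edges_le f g hf0 hg0) (by positivity))
  rw [probGnp, Finset.mul_sum]
  refine Finset.sum_le_sum fun G _ => ?_
  have hnn : 0 ≤ (∏ e ∈ edges G, f e) * ∏ e ∈ edges ⊤ \ edges G, g e :=
    mul_nonneg (Finset.prod_nonneg fun e _ => hf0 e) (Finset.prod_nonneg fun e _ => hg0 e)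
  rw [Set.indicator_apply]
  split_ifs with hG
  swap
  · positivity
  obtain ⟨hΓ, hK⟩ := hG
  have hfG : ∏ e ∈ edges G, f e =
      p ^ G.edgeSet.ncard * 2⁻¹ ^ (G.edgeSet ∩ B).ncard := by
    simp only [hf]
    rw [Finset.prod_mul_distrib, Finset.prod_const, ← Finset.prod_filter, Finset.prod_const,
      ncard_edgeSet_eq_card_edges]
    congr 2
    rw [← Set.ncard_coe_finset]
    congr 1
    ext e
    simp [mem_edges]
  have hgG : ∏ e ∈ edges ⊤ \ edges G, g e = (1 - p) ^ (n.choose 2 - G.edgeSet.ncard) := by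
    rw [ncard_edgeSet_eq_card_edges, ← card_edges_top,
      ← Finset.card_sdiff_of_subset (edges_subset_top G)]
    apply Finset.prod_eq_pow_card
    intro e he
    have : e ∉ Γ.edgeSet := fun h =>
      (Finset.mem_sdiff.1 he).2 (mem_edges.2 (edgeSet_mono hΓ h))
    simp [hg, this]
  rw [hfG, hgG]
  have h2 : (1 : ℝ) ≤ 2 ^ K * 2⁻¹ ^ (G.edgeSet ∩ B).ncard := by
    rw [inv_pow, ← Real.rpow_natCast, ← div_eq_mul_inv, one_le_div (by positivity)]
    exact Real.rpow_le_rpow_of_exponent_le (by norm_num) hK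
  have h3 : 0 ≤ p ^ G.edgeSet.ncard * (1 - p) ^ (n.choose 2 - G.edgeSet.ncard) :=
    mul_nonneg (by positivity) (pow_nonneg (by linarith) _)
  calc p ^ G.edgeSet.ncard * (1 - p) ^ (n.choose 2 - G.edgeSet.ncard)
      ≤ (2 ^ K * 2⁻¹ ^ (G.edgeSet ∩ B).ncard) *
        (p ^ G.edgeSet.ncard * (1 - p) ^ (n.choose 2 - G.edgeSet.ncard)) :=
        le_mul_of_one_le_left h3 h2
    _ = _ := by ring

/-- The expected number of subgraphs of `G(n,p)` with at most `M` edges. -/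
lemma sum_pow_ncard_edgeSet_le {n : ℕ} {p M a : ℝ} (hp0 : 0 ≤ p) (ha : 0 ≤ a)
    {S : Finset (SimpleGraph (Fin n))} (hS : ∀ Γ ∈ S, (Γ.edgeSet.ncard : ℝ) ≤ M) :
    ∑ Γ ∈ S, p ^ Γ.edgeSet.ncard ≤
      Real.exp (a * M + p * Real.exp (-a) * n.choose 2) := by
  have h1 : ∀ Γ ∈ S, p ^ Γ.edgeSet.ncard ≤
      Real.exp (a * M) * (p * Real.exp (-a)) ^ Γ.edgeSet.ncard := by
    intro Γ hΓ
    rw [mul_pow, ← Real.exp_nat_mul, mul_left_comm, ← Real.exp_add]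
    refine le_mul_of_one_le_right (by positivity) (Real.one_le_exp ?_)
    nlinarith [hS Γ hΓ]
  have h2 := sum_prod_edges_le (n := n) (fun _ => p * Real.exp (-a)) (fun _ => 1)
    (fun _ => by positivity) (fun _ => zero_le_one)
  simp only [Finset.prod_const, one_pow, mul_one, ← ncard_edgeSet_eq_card_edges] at h2
  calc ∑ Γ ∈ S, p ^ Γ.edgeSet.ncard
      ≤ ∑ Γ ∈ S, Real.exp (a * M) * (p * Real.exp (-a)) ^ Γ.edgeSet.ncard := Finset.sum_le_sum h1
    _ = Real.exp (a * M) * ∑ Γ ∈ S, (p * Real.exp (-a)) ^ Γ.edgeSet.ncard := by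
        rw [Finset.mul_sum]
    _ ≤ Real.exp (a * M) * ∑ Γ : SimpleGraph (Fin n), (p * Real.exp (-a)) ^ Γ.edgeSet.ncard := by
        gcongr
        exact Finset.subset_univ S
    _ ≤ Real.exp (a * M) * (p * Real.exp (-a) + 1) ^ n.choose 2 := by
        gcongr
        rwa [ncard_edgeSet_eq_card_edges, card_edges_top] at h2
    _ ≤ Real.exp (a * M) * Real.exp (p * Real.exp (-a)) ^ n.choose 2 := by
        gcongr
        exact Real.add_one_le_exp _
    _ = _ := by
        rw [← Real.exp_nat_mul, ← Real.exp_add]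
        ring_nf

lemma probGnp_le_sum {n : ℕ} {p : ℝ} (hp0 : 0 ≤ p) (hp1 : p ≤ 1) {ι : Type*} (S : Finset ι)
    (Q : ι → Set (SimpleGraph (Fin n))) {P : Set (SimpleGraph (Fin n))}
    (hP : ∀ G ∈ P, ∃ i ∈ S, G ∈ Q i) : probGnp n p P ≤ ∑ i ∈ S, probGnp n p (Q i) := by
  classical
  simp only [probGnp]
  rw [Finset.sum_comm]
  refine Finset.sum_le_sum fun G _ => ?_
  have h0 : 0 ≤ p ^ G.edgeSet.ncard * (1 - p) ^ (n.choose 2 - G.edgeSet.ncard) :=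
    mul_nonneg (by positivity) (pow_nonneg (by linarith) _)
  have hnn : ∀ i ∈ S, 0 ≤ (Q i).indicator
      (fun G => p ^ G.edgeSet.ncard * (1 - p) ^ (n.choose 2 - G.edgeSet.ncard)) G := by
    intro i _
    rw [Set.indicator_apply]
    split_ifs
    exacts [h0, le_rfl]
  by_cases hG : G ∈ P
  · obtain ⟨i, hi, hGi⟩ := hP G hG
    refine le_trans ?_ (Finset.single_le_sum hnn hi)
    rw [Set.indicator_of_mem hG, Set.indicator_of_mem hGi]
  · rw [Set.indicator_of_notMem hG]
    exact Finset.sum_nonneg hnn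

end RandomGraph

/-- For all large enough `n` and every `p` with
`ln n / n < p ≤ 2 ln n / n`: the probability that `G ~ G(n,p)` contains a spanning subgraph
`Γ ≤ G` which is a non-Hamiltonian `(⌊n/5⌋, 2)`-expander with at most `n·(ln n)^{0.98}`
edges and with `|E(G) ∩ B_Γ| ≤ n·ln n / 100`, is at most `exp(-n²p/401)`. -/
theorem stmt18 :
    ∃ n0 : ℕ, 0 < n0 ∧ ∀ n : ℕ, n0 ≤ n →
      ∀ p : ℝ, Real.log n / n < p → p ≤ 2 * Real.log n / n →
        probGnp n p {G | ∃ Γ : SimpleGraph (Fin n), Γ ≤ G ∧ ¬Γ.IsHamiltonian ∧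
            IsExpander Γ ((n / 5 : ℕ) : ℝ) 2 ∧
            (Γ.edgeSet.ncard : ℝ) ≤ (n : ℝ) * Real.log n ^ (0.98 : ℝ) ∧
            ((G.edgeSet ∩ boosters Γ).ncard : ℝ) ≤ (n : ℝ) * Real.log n / 100} ≤
          Real.exp (-(n : ℝ) ^ 2 * p / 401) := by
  have hev : ∀ᶠ n : ℕ in Filter.atTop, (40000 : ℝ) ^ 50 ≤ Real.log n :=
    (Real.tendsto_log_atTop.comp tendsto_natCast_atTop_atTop).eventually_ge_atTop _
  obtain ⟨n1, hn1⟩ := Filter.eventually_atTop.1 hev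
  refine ⟨max n1 25, by lia, fun n hn p hp hp' => ?_⟩
  have hlog := hn1 n (by lia)
  have hn25 : 25 ≤ n := by lia
  have hn0 : (0 : ℝ) < n := by positivity
  set L := Real.log n with hL
  have hL0 : 0 < L := lt_of_lt_of_le (by positivity) hlog
  have hp0 : 0 < p := lt_trans (by positivity) hp
  have hp1 : p ≤ 1 := by
    refine hp'.trans ?_
    rw [div_le_one hn0]
    have h1 := Real.log_le_sub_one_of_pos (show (0 : ℝ) < n / 2 by positivity)
    rw [Real.log_div (by positivity) (by norm_num)] at h1
    linarith [Real.log_two_lt_d9]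
  have hLp : n * L ≤ (n : ℝ) ^ 2 * p := by
    rw [div_lt_iff₀ hn0] at hp
    nlinarith
  set K := (n : ℝ) * L / 100 with hK
  set M := (n : ℝ) * L ^ (0.98 : ℝ) with hM
  have hML : 40000 * M ≤ n * L := by
    have h1 : (40000 : ℝ) ≤ L ^ (0.02 : ℝ) := by
      calc (40000 : ℝ) = ((40000 : ℝ) ^ (50 : ℕ)) ^ (0.02 : ℝ) := by
            rw [← Real.rpow_natCast, ← Real.rpow_mul (by norm_num)]
            norm_num
        _ ≤ L ^ (0.02 : ℝ) := by gcongr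
    have h2 : L ^ (0.02 : ℝ) * L ^ (0.98 : ℝ) = L := by
      rw [← Real.rpow_add hL0]
      norm_num
    have h3 : 0 ≤ L ^ (0.98 : ℝ) := by positivity
    calc 40000 * M = n * (40000 * L ^ (0.98 : ℝ)) := by rw [hM]; ring
      _ ≤ n * (L ^ (0.02 : ℝ) * L ^ (0.98 : ℝ)) := by gcongr
      _ = n * L := by rw [h2]
  classical
  let S : Finset (SimpleGraph (Fin n)) := {Γ | ¬Γ.IsHamiltonian ∧
    IsExpander Γ ((n / 5 : ℕ) : ℝ) 2 ∧ (Γ.edgeSet.ncard : ℝ) ≤ M}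
  have hSM : ∀ Γ ∈ S, (Γ.edgeSet.ncard : ℝ) ≤ M := fun Γ hΓ => (Finset.mem_filter.1 hΓ).2.2.2
  have hexp : Real.exp (-8) ≤ 1 / 2000 := by
    rw [Real.exp_neg, one_div]
    apply inv_anti₀ (by norm_num)
    calc (2000 : ℝ) ≤ 2.7 ^ 8 := by norm_num
      _ ≤ Real.exp 1 ^ 8 := by
        gcongr
        linarith [Real.exp_one_gt_d9]
      _ = Real.exp 8 := by rw [← Real.exp_nat_mul]; norm_num
  have hchoose : (n.choose 2 : ℝ) ≤ (n : ℝ) ^ 2 / 2 := by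
    rw [Nat.cast_choose_two]
    nlinarith
  have hterm : ∀ Γ ∈ S, probGnp n p {G | Γ ≤ G ∧ ((G.edgeSet ∩ boosters Γ).ncard : ℝ) ≤ K} ≤
      Real.exp (K * Real.log 2 - p * n ^ 2 / 100) * p ^ Γ.edgeSet.ncard := by
    intro Γ hΓ
    obtain ⟨-, hham, hexpander, -⟩ := Finset.mem_filter.1 hΓ
    refine (probGnp_le_of_disjoint hp0.le hp1 Γ fun e he => ⟨he.1, he.2.1⟩).trans ?_
    have hb : (n : ℝ) ^ 2 ≤ 50 * (boosters Γ).ncard := by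
      exact_mod_cast hexpander.sq_le_ncard_boosters hn25 hham
    have h1 : (1 - p / 2) ^ (boosters Γ).ncard ≤ Real.exp (-(p * n ^ 2 / 100)) := by
      calc (1 - p / 2) ^ (boosters Γ).ncard ≤ Real.exp (-(p / 2)) ^ (boosters Γ).ncard := by
            gcongr
            · linarith
            · linarith [Real.add_one_le_exp (-(p / 2))]
        _ = Real.exp ((boosters Γ).ncard * -(p / 2)) := by rw [← Real.exp_nat_mul]
        _ ≤ _ := by
            gcongr
            nlinarith
    calc (2 : ℝ) ^ K * (p ^ Γ.edgeSet.ncard * (1 - p / 2) ^ (boosters Γ).ncard)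
        ≤ 2 ^ K * (p ^ Γ.edgeSet.ncard * Real.exp (-(p * n ^ 2 / 100))) := by gcongr
      _ = _ := by
        rw [Real.rpow_def_of_pos (by norm_num), sub_eq_add_neg, Real.exp_add,
          mul_comm (Real.log 2)]
        ring
  calc _ ≤ ∑ Γ ∈ S, probGnp n p {G | Γ ≤ G ∧ ((G.edgeSet ∩ boosters Γ).ncard : ℝ) ≤ K} := by
        apply probGnp_le_sum hp0.le hp1
        rintro G ⟨Γ, h1, h2, h3, h4, h5⟩
        exact ⟨Γ, Finset.mem_filter.2 ⟨Finset.mem_univ _, h2, h3, h4⟩, h1, h5⟩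
    _ ≤ ∑ Γ ∈ S, Real.exp (K * Real.log 2 - p * n ^ 2 / 100) * p ^ Γ.edgeSet.ncard :=
        Finset.sum_le_sum hterm
    _ = Real.exp (K * Real.log 2 - p * n ^ 2 / 100) * ∑ Γ ∈ S, p ^ Γ.edgeSet.ncard := by
        rw [Finset.mul_sum]
    _ ≤ Real.exp (K * Real.log 2 - p * n ^ 2 / 100) *
        Real.exp (8 * M + p * Real.exp (-8) * n.choose 2) := by
        gcongr
        exact sum_pow_ncard_edgeSet_le hp0.le (by norm_num) hSM
    _ ≤ Real.exp (-(n : ℝ) ^ 2 * p / 401) := by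
        rw [← Real.exp_add, Real.exp_le_exp]
        have h1 : p * Real.exp (-8) * n.choose 2 ≤ p * (1 / 2000) * ((n : ℝ) ^ 2 / 2) := by
          gcongr
        have h2 : K * Real.log 2 ≤ (n : ℝ) ^ 2 * p / 100 * 0.6931471808 := by
          have : K ≤ (n : ℝ) ^ 2 * p / 100 := by rw [hK]; linarith
          gcongr
          exact Real.log_two_lt_d9.le
        have h3 : 0 < (n : ℝ) ^ 2 * p := by positivity
        linarith
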